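/- Let ρ be a compatible sl₂(ℂ)-representation on A and ρ_ε a compatible infinitesimal deformation with L_ε = L + εv. A primitive element α ∈ P^n remains primitive with respect to the deformed representation, i.e. Λ_ε(α) = 0 in A[ε], if and only if L^{N−n}(αv) = 0. -/

import Mathlib

/-- A compatible `sl₂(ℂ)`-representation on a graded algebra `A = ⊕ₙ Aⁿ` (graded pieces
`𝒜 n`, indexed by `ℤ`): the generators `L`, `Λ`, `B` satisfy the `sl₂` commutation
relations, `L` and `Λ` are homogeneous of degree `2` and `-2`, `B` acts on `Aⁿ` as
multiplication by `N - n`, and `L(αβ) = L(α)β`. -/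
structure CompatSL2 (N : ℕ) (A : Type) [Ring A] [Algebra ℂ A]
    (𝒜 : ℤ → Submodule ℂ A) : Type where
  L : Module.End ℂ A
  Lam : Module.End ℂ A
  B : Module.End ℂ A
  comm_LamL : Lam * L - L * Lam = B
  comm_BL : B * L - L * B = (-2 : ℂ) • L
  comm_BLam : B * Lam - Lam * B = (2 : ℂ) • Lam
  L_deg : ∀ (n : ℤ), ∀ x ∈ 𝒜 n, L x ∈ 𝒜 (n + 2)
  Lam_deg : ∀ (n : ℤ), ∀ x ∈ 𝒜 n, Lam x ∈ 𝒜 (n - 2)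
  B_weight : ∀ (n : ℤ), ∀ x ∈ 𝒜 n, B x = ((N : ℤ) - n) • x
  L_mul : ∀ a b : A, L (a * b) = L a * b

/-- The endomorphism `f + ε g` of `A[ε] = A ⊗ ℂ[ε]/(ε²)`, identified with `A × A` via
`a + ε b ↔ (a, b)`; it sends `a + εb` to `f a + ε (f b + g a)`. -/
def deform {A : Type} [Ring A] [Algebra ℂ A] (f g : Module.End ℂ A) :
    Module.End ℂ (A × A) :=
  f.prodMap f + (LinearMap.inr ℂ A A) ∘ₗ g ∘ₗ (LinearMap.fst ℂ A A)

/-- The deformed Lefschetz operator `L_ε = L + ε v`, where `v` acts by (right)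
multiplication. -/
def Leps {A : Type} [Ring A] [Algebra ℂ A] (L : Module.End ℂ A) (v : A) :
    Module.End ℂ (A × A) :=
  deform L (LinearMap.mulRight ℂ v)

/-- The deformed dual Lefschetz operator `Λ_ε = Λ + ε [Λ, φ]`. -/
def Lameps {A : Type} [Ring A] [Algebra ℂ A] (Lam φ : Module.End ℂ A) :
    Module.End ℂ (A × A) :=
  deform Lam (Lam * φ - φ * Lam)

namespace CompatSL2

variable {N : ℕ} {A : Type} [Ring A] [Algebra ℂ A] {𝒜 : ℤ → Submodule ℂ A}

theorem B_apply (S : CompatSL2 N A 𝒜) {n : ℤ} {x : A} (hx : x ∈ 𝒜 n) :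
    S.B x = ((N : ℂ) - n) • x := by
  rw [S.B_weight n x hx, ← Int.cast_smul_eq_zsmul ℂ]
  push_cast
  rfl

theorem L_pow_mem (S : CompatSL2 N A 𝒜) {n : ℤ} {x : A} (hx : x ∈ 𝒜 n) (j : ℕ) :
    (S.L ^ j) x ∈ 𝒜 (n + 2 * j) := by
  induction j with
  | zero => simpa using hx
  | succ j ih =>
    rw [pow_succ', Module.End.mul_apply]
    have h := S.L_deg _ _ ih
    rwa [show n + 2 * (j : ℤ) + 2 = n + 2 * ((j + 1 : ℕ) : ℤ) by push_cast; ring] at h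

theorem Lam_pow_mem (S : CompatSL2 N A 𝒜) {n : ℤ} {x : A} (hx : x ∈ 𝒜 n) (j : ℕ) :
    (S.Lam ^ j) x ∈ 𝒜 (n - 2 * j) := by
  induction j with
  | zero => simpa using hx
  | succ j ih =>
    rw [pow_succ', Module.End.mul_apply]
    have h := S.Lam_deg _ _ ih
    rwa [show n - 2 * (j : ℤ) - 2 = n - 2 * ((j + 1 : ℕ) : ℤ) by push_cast; ring] at h

theorem Lam_L_apply (S : CompatSL2 N A 𝒜) {n : ℤ} {x : A} (hx : x ∈ 𝒜 n) :
    S.Lam (S.L x) = S.L (S.Lam x) + ((N : ℂ) - n) • x := by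
  rw [← S.B_apply hx, ← S.comm_LamL]
  simp

theorem Lam_L_pow_succ (S : CompatSL2 N A 𝒜) {n : ℤ} {x : A} (hx : x ∈ 𝒜 n) (j : ℕ) :
    S.Lam ((S.L ^ (j + 1)) x) =
      (S.L ^ (j + 1)) (S.Lam x) + (((j : ℂ) + 1) * ((N : ℂ) - n - j)) • (S.L ^ j) x := by
  induction j with
  | zero => simpa using S.Lam_L_apply hx
  | succ j ih =>
    rw [pow_succ' S.L (j + 1), Module.End.mul_apply, S.Lam_L_apply (S.L_pow_mem hx (j + 1)), ih,
      map_add, map_smul, Module.End.mul_apply, add_assoc, ← Module.End.mul_apply S.L (S.L ^ j),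
      ← pow_succ', ← add_smul]
    congr 2
    push_cast
    ring

/-- A primitive vector killed by `L ^ m` vanishes unless its weight is one of `0, …, m - 1`. -/
theorem eq_zero_of_L_pow_eq_zero (S : CompatSL2 N A 𝒜) {n : ℤ} {x : A} (hx : x ∈ 𝒜 n)
    (hp : S.Lam x = 0) (m : ℕ) (hm : ∀ j : ℕ, j < m → (N : ℤ) - n ≠ j)
    (h : (S.L ^ m) x = 0) : x = 0 := by
  induction m with
  | zero => simpa using h
  | succ m ih =>
    refine ih (fun j hj => hm j (by omega)) ?_
    have key := S.Lam_L_pow_succ hx m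
    rw [h, hp, map_zero, map_zero, zero_add] at key
    refine (smul_eq_zero.mp key.symm).resolve_left (mul_ne_zero ?_ ?_)
    · exact_mod_cast Nat.succ_ne_zero m
    · have := sub_ne_zero.mpr (hm m (by omega))
      exact_mod_cast this

theorem eq_zero_of_neg_weight (S : CompatSL2 N A 𝒜)
    (hbound : ∀ n : ℤ, (n < 0 ∨ 2 * (N : ℤ) < n) → 𝒜 n = ⊥) {n : ℤ} {x : A} (hx : x ∈ 𝒜 n)
    (hp : S.Lam x = 0) (hn : (N : ℤ) < n) : x = 0 := by
  refine S.eq_zero_of_L_pow_eq_zero hx hp N (fun j _ => by omega) ?_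
  have h := S.L_pow_mem hx N
  rwa [hbound _ (Or.inr (by omega)), Submodule.mem_bot] at h

theorem L_pow_Lam_eq_zero (S : CompatSL2 N A 𝒜) {n : ℤ} {x : A} (hx : x ∈ 𝒜 n) {k : ℕ}
    (hk : (N : ℤ) - n = k) (h : (S.L ^ (k + 1)) x = 0) : (S.L ^ (k + 1)) (S.Lam x) = 0 := by
  have key := S.Lam_L_pow_succ hx k
  have hc : (N : ℂ) - n = k := by exact_mod_cast congrArg (Int.cast : ℤ → ℂ) hk
  rw [h, hc] at key
  simpa using key.symm

/-- The operator `L ^ m` is injective on the weight space of weight `m`. -/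
theorem eq_zero_of_L_pow_weight (S : CompatSL2 N A 𝒜)
    (hbound : ∀ n : ℤ, (n < 0 ∨ 2 * (N : ℤ) < n) → 𝒜 n = ⊥) {n : ℤ} {x : A} (hx : x ∈ 𝒜 n)
    {m : ℕ} (hm : (N : ℤ) - n = m) (h : (S.L ^ m) x = 0) : x = 0 := by
  obtain ⟨r, hr⟩ : ∃ r : ℕ, (S.Lam ^ r) x = 0 := by
    refine ⟨n.toNat + 1, ?_⟩
    have h := S.Lam_pow_mem hx (n.toNat + 1)
    rwa [hbound _ (Or.inl (by push_cast; omega)), Submodule.mem_bot] at h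
  induction r generalizing n x m with
  | zero => simpa using hr
  | succ r ih =>
    have hL : (S.L ^ (m + 1)) x = 0 := by
      rw [pow_succ', Module.End.mul_apply, h, map_zero]
    refine S.eq_zero_of_L_pow_eq_zero hx ?_ m (fun j hj => by omega) h
    refine ih (S.Lam_deg n x hx) (m := m + 2) (by push_cast; omega) ?_ ?_
    · rw [pow_succ', Module.End.mul_apply, S.L_pow_Lam_eq_zero hx hm hL, map_zero]
    · rwa [pow_succ, Module.End.mul_apply] at hr

/-- In weight `k`, the primitive vectors are exactly those killed by `L ^ (k + 1)`. -/
theorem Lam_eq_zero_iff (S : CompatSL2 N A 𝒜)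
    (hbound : ∀ n : ℤ, (n < 0 ∨ 2 * (N : ℤ) < n) → 𝒜 n = ⊥) {n : ℤ} {x : A} (hx : x ∈ 𝒜 n)
    {k : ℕ} (hk : (N : ℤ) - n = k) : S.Lam x = 0 ↔ (S.L ^ (k + 1)) x = 0 := by
  constructor
  · intro hp
    refine S.eq_zero_of_neg_weight hbound (S.L_pow_mem hx (k + 1)) ?_ (by push_cast; omega)
    have hc : (N : ℂ) - n = k := by exact_mod_cast congrArg (Int.cast : ℤ → ℂ) hk
    rw [S.Lam_L_pow_succ hx, hp, hc]
    simp
  · intro h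
    refine S.eq_zero_of_L_pow_weight hbound (S.Lam_deg n x hx) (m := k + 2)
      (by push_cast; omega) ?_
    rw [pow_succ', Module.End.mul_apply, S.L_pow_Lam_eq_zero hx hk h, map_zero]

theorem L_pow_mul (S : CompatSL2 N A 𝒜) (j : ℕ) (a b : A) :
    (S.L ^ j) (a * b) = (S.L ^ j) a * b := by
  induction j with
  | zero => simp
  | succ j ih => simp only [pow_succ', Module.End.mul_apply, ih, S.L_mul]

theorem L_pow_succ_apply_of_commutator (S : CompatSL2 N A 𝒜) {φ : Module.End ℂ A} {v : A}
    (hφL : S.L * φ - φ * S.L = LinearMap.mulRight ℂ v) (j : ℕ) (a : A) :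
    (S.L ^ (j + 1)) (φ a) =
      φ ((S.L ^ (j + 1)) a) + ((j : ℂ) + 1) • (S.L ^ j) (a * v) := by
  have hL (x : A) : S.L (φ x) = φ (S.L x) + x * v :=
    sub_eq_iff_eq_add'.mp (LinearMap.congr_fun hφL x)
  induction j with
  | zero => simp [hL]
  | succ j ih =>
    rw [pow_succ' S.L (j + 1), Module.End.mul_apply, ih, map_add, hL, map_smul,
      ← Module.End.mul_apply S.L (S.L ^ j), ← pow_succ', ← S.L_pow_mul, Module.End.mul_apply]
    push_cast
    module

end CompatSL2

/-- **Corollary (Huybrechts, Cor. 1.8).** For a compatible deformation with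
`L_ε = L + εv`, a primitive element `α ∈ Pⁿ` stays primitive with respect to the deformed
representation (i.e. `Λ_ε(α) = 0` in `A[ε]`, modelled as `A × A`) if and only if
`L^{N−n}(αv) = 0`. -/
theorem stays_primitive_iff
    (N : ℕ) (A : Type) [Ring A] [Algebra ℂ A] [FiniteDimensional ℂ A]
    (𝒜 : ℤ → Submodule ℂ A) [GradedAlgebra 𝒜]
    (hbound : ∀ n : ℤ, (n < 0 ∨ 2 * (N : ℤ) < n) → 𝒜 n = ⊥)
    (hgc : ∀ (p q : ℤ), ∀ x ∈ 𝒜 p, ∀ y ∈ 𝒜 q, x * y = ((-1 : ℂ) ^ (p * q)) • (y * x))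
    (S : CompatSL2 N A 𝒜)
    (φ : Module.End ℂ A) (v : A) (hv : v ∈ 𝒜 2)
    (hφ0 : ∀ (n : ℤ), ∀ x ∈ 𝒜 n, φ x ∈ 𝒜 n)
    (hφL : S.L * φ - φ * S.L = LinearMap.mulRight ℂ v)
    (n : ℤ)
    (α : A) (hαm : α ∈ 𝒜 n) (hαp : S.Lam α = 0) :
    Lameps S.Lam φ (α, (0 : A)) = 0 ↔ (S.L ^ ((N : ℤ) - n).toNat) (α * v) = 0 := by
  have hΛ : Lameps S.Lam φ (α, (0 : A)) = 0 ↔ S.Lam (φ α) = 0 := by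
    simp [Lameps, deform, hαp]
  rw [hΛ]
  rcases lt_or_ge (N : ℤ) n with hn | hn
  · simp [S.eq_zero_of_neg_weight hbound hαm hαp hn]
  obtain ⟨k, hk⟩ := Int.eq_ofNat_of_zero_le (sub_nonneg.mpr hn)
  rw [hk, Int.toNat_natCast, S.Lam_eq_zero_iff hbound (hφ0 n α hαm) hk,
    S.L_pow_succ_apply_of_commutator hφL, (S.Lam_eq_zero_iff hbound hαm hk).mp hαp, map_zero,
    zero_add, smul_eq_zero, or_iff_right]
  exact_mod_cast Nat.succ_ne_zero k
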